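/- arXiv:2204.04023 — 10 statements merged into one kernel-verified Lean document; each statement's English description precedes it below -/
import Mathlib

section
/- Let a ∈ ℝ, T > 0, let α be a positive real number that is not an integer, and let y be ⌈α⌉ times continuously differentiable on [a, a+T]. Then for every fixed w ∈ ℝ, the function t ↦ φ^D(w, t) satisfies φ^D(w, a) = 0, and for every t ∈ [a, a+T] its derivative with respect to t (taken within [a, a+T]) equals -e^w · φ^D(w, t) + (-1)^⌊α⌋ · (sin(απ)/π) · e^{w·q_D} · y^{(⌈α⌉)}(t). -/
open Real MeasureTheory Set

/-- The diffusive kernel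
`φ^D(w, t) = (-1)^⌊α⌋ · (sin(απ)/π) · e^{w·q_D} · ∫_a^t y^{(⌈α⌉)}(τ) · exp(-(t-τ)·e^w) dτ`,
with `q_D = α - ⌈α⌉ + 1` and `y^{(⌈α⌉)}` the `⌈α⌉`-th derivative of `y` on `[a, a+T]`. -/
noncomputable def phiD (a T α : ℝ) (y : ℝ → ℝ) (w t : ℝ) : ℝ :=
  (-1 : ℝ) ^ ⌊α⌋ * (Real.sin (α * π) / π) * Real.exp (w * (α - (⌈α⌉ : ℝ) + 1)) *
    ∫ τ in a..t, iteratedDerivWithin ⌈α⌉₊ y (Set.Icc a (a + T)) τ * Real.exp (-(t - τ) * Real.exp w)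

/-- Duhamel's formula: the convolution of a continuous function with a decaying exponential
solves the corresponding linear inhomogeneous ODE. -/
theorem hasDerivWithinAt_integral_mul_exp {a b c t : ℝ} {f : ℝ → ℝ}
    (hf : ContinuousOn f (Set.Icc a b)) (ht : t ∈ Set.Icc a b) :
    HasDerivWithinAt (fun s => ∫ τ in a..s, f τ * Real.exp (-(s - τ) * c))
      (-c * (∫ τ in a..t, f τ * Real.exp (-(t - τ) * c)) + f t) (Set.Icc a b) t := by
  have factor (s : ℝ) : ∫ τ in a..s, f τ * Real.exp (-(s - τ) * c) =
      Real.exp (-(s * c)) * ∫ τ in a..s, f τ * Real.exp (τ * c) := by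
    rw [← intervalIntegral.integral_const_mul]
    congr 1 with τ
    rw [mul_left_comm, ← Real.exp_add]
    ring_nf
  have hg : ContinuousOn (fun τ => f τ * Real.exp (τ * c)) (Set.Icc a b) :=
    hf.mul (by fun_prop)
  have hint : IntervalIntegrable (fun τ => f τ * Real.exp (τ * c)) volume a t :=
    (hg.mono (Set.Icc_subset_Icc_right ht.2)).intervalIntegrable_of_Icc ht.1
  have : Fact (t ∈ Set.Icc a b) := ⟨ht⟩
  have hI := intervalIntegral.integral_hasDerivWithinAt_right (s := Set.Icc a b)
    (t := Set.Icc a b) hint (hg.stronglyMeasurableAtFilter_nhdsWithin measurableSet_Icc t) (hg t ht)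
  have hE : HasDerivAt (fun s : ℝ => Real.exp (-(s * c))) (Real.exp (-(t * c)) * -c) t := by
    simpa using ((hasDerivAt_id t).mul_const c).neg.exp
  simp only [factor]
  refine (hE.hasDerivWithinAt.mul hI).congr_deriv ?_
  have h : Real.exp (-(t * c)) * Real.exp (t * c) = 1 := by simp [← Real.exp_add]
  linear_combination f t * h

/-- For fixed `w ∈ ℝ`, the function `t ↦ φ^D(w, t)` vanishes at `t = a` and
for every `t ∈ [a, a+T]` solves (within `[a, a+T]`) the ODE
`∂φ^D/∂t (w,t) = -e^w · φ^D(w,t) + (-1)^⌊α⌋ · (sin(απ)/π) · e^{w·q_D} · y^{(⌈α⌉)}(t)`. -/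
theorem phiD_solves_ivp (a T α : ℝ) (hT : 0 < T) (hα : 0 < α) (hαni : ∀ n : ℤ, α ≠ n)
    (y : ℝ → ℝ) (hy : ContDiffOn ℝ (⌈α⌉₊ : ℕ∞) y (Set.Icc a (a + T))) (w : ℝ) :
    phiD a T α y w a = 0 ∧
    ∀ t ∈ Set.Icc a (a + T),
      HasDerivWithinAt (fun s => phiD a T α y w s)
        (-Real.exp w * phiD a T α y w t +
          (-1 : ℝ) ^ ⌊α⌋ * (Real.sin (α * π) / π) * Real.exp (w * (α - (⌈α⌉ : ℝ) + 1)) *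
            iteratedDerivWithin ⌈α⌉₊ y (Set.Icc a (a + T)) t)
        (Set.Icc a (a + T)) t := by
  refine ⟨by simp [phiD], fun t ht => ?_⟩
  have hf : ContinuousOn (iteratedDerivWithin ⌈α⌉₊ y (Set.Icc a (a + T))) (Set.Icc a (a + T)) :=
    hy.continuousOn_iteratedDerivWithin le_rfl (uniqueDiffOn_Icc (by linarith))
  refine ((hasDerivWithinAt_integral_mul_exp (c := Real.exp w) hf ht).const_mul _).congr_deriv ?_
  simp only [phiD]
  ring
end

section
/- Let a ∈ ℝ, T > 0, let α be a positive real number that is not an integer, and let y be ⌈α⌉ times continuously differentiable on [a, a+T]. Then for every t ∈ [a, a+T], the Caputo derivative satisfies D_a^α y(t) = ∫_{-∞}^{∞} φ^D(w, t) dw. -/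
open Real MeasureTheory Set

/-- The Caputo fractional derivative of order `α` (with `m = ⌈α⌉`) with starting point `a`:
`D_a^α y(t) = (1/Γ(m-α)) · ∫_a^t (t-τ)^{m-α-1} · y^{(m)}(τ) dτ`,
where `y^{(m)}` is the `m`-th derivative of `y` on `[a, a+T]`. -/
noncomputable def caputoDeriv (a T α : ℝ) (y : ℝ → ℝ) (t : ℝ) : ℝ :=
  (1 / Real.Gamma ((⌈α⌉₊ : ℝ) - α)) *
    ∫ τ in a..t, (t - τ) ^ ((⌈α⌉₊ : ℝ) - α - 1) *
      iteratedDerivWithin ⌈α⌉₊ y (Set.Icc a (a + T)) τ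

/-- The substitution `x = exp w` turns an integral over `ℝ` into one over `(0, ∞)`. -/
theorem integral_exp_mul_mul_exp_neg_mul_exp {q r : ℝ} (hq : 0 < q) (hr : 0 < r) :
    ∫ w : ℝ, Real.exp (w * q) * Real.exp (-r * Real.exp w) = Real.Gamma q * r ^ (-q) := by
  have h := integral_image_eq_integral_abs_deriv_smul (s := univ) (f := Real.exp)
    (f' := Real.exp) MeasurableSet.univ (fun x _ => (Real.hasDerivAt_exp x).hasDerivWithinAt)
    Real.exp_injective.injOn (fun x => x ^ (q - 1) * Real.exp (-(r * x)))
  rw [image_univ, Real.range_exp, Real.integral_rpow_mul_exp_neg_mul_Ioi hq hr,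
    setIntegral_univ] at h
  have hpow : Real.Gamma q * r ^ (-q) = (1 / r) ^ q * Real.Gamma q := by
    rw [one_div, Real.inv_rpow hr.le, Real.rpow_neg hr.le, mul_comm]
  rw [hpow, h]
  refine integral_congr_ae (Filter.Eventually.of_forall fun w => ?_)
  simp only [smul_eq_mul, abs_of_pos (Real.exp_pos w)]
  rw [← Real.exp_mul, ← mul_assoc, ← Real.exp_add w, neg_mul]
  congr 2
  ring

theorem integrable_exp_mul_mul_exp_neg_mul_exp {q r : ℝ} (hq : 0 < q) (hr : 0 < r) :
    Integrable fun w : ℝ => Real.exp (w * q) * Real.exp (-r * Real.exp w) := by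
  refine Integrable.of_integral_ne_zero ?_
  rw [integral_exp_mul_mul_exp_neg_mul_exp hq hr]
  exact mul_ne_zero (Real.Gamma_pos_of_pos hq).ne' (Real.rpow_pos_of_pos hr _).ne'

theorem intervalIntegrable_sub_rpow_mul {a t q : ℝ} (hq : q < 1) {g : ℝ → ℝ}
    (hg : ContinuousOn g (uIcc a t)) :
    IntervalIntegrable (fun τ => (t - τ) ^ (-q) * g τ) volume a t := by
  have h := (intervalIntegral.intervalIntegrable_rpow' (a := t - a) (b := 0)
    (r := -q) (by linarith)).comp_sub_left t
  simp only [sub_sub_cancel, sub_zero] at h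
  exact h.mul_continuousOn hg

/-- Fubini's theorem for the diffusive kernel of a continuous function. -/
theorem integral_exp_mul_intervalIntegral {a t q : ℝ} (hat : a ≤ t) (hq0 : 0 < q) (hq1 : q < 1)
    {g : ℝ → ℝ} (hg : ContinuousOn g (Icc a t)) :
    ∫ w : ℝ, Real.exp (w * q) * ∫ τ in a..t, g τ * Real.exp (-(t - τ) * Real.exp w) =
      Real.Gamma q * ∫ τ in a..t, (t - τ) ^ (-q) * g τ := by
  have hlt : ∀ᵐ τ ∂volume.restrict (Ioc a t), τ < t := by
    rw [← restrict_Ioo_eq_restrict_Ioc]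
    exact (ae_restrict_mem measurableSet_Ioo).mono fun τ h => h.2
  have hmeas : AEStronglyMeasurable g (volume.restrict (Ioc a t)) :=
    (hg.mono Ioc_subset_Icc_self).aestronglyMeasurable measurableSet_Ioc
  have hint : IntegrableOn (fun τ => (t - τ) ^ (-q) * g τ) (Ioc a t) :=
    (intervalIntegrable_iff_integrableOn_Ioc_of_le hat).1
      (intervalIntegrable_sub_rpow_mul hq1 (by rwa [uIcc_of_le hat]))
  let F : ℝ × ℝ → ℝ := fun p =>
    g p.2 * (Real.exp (p.1 * q) * Real.exp (-(t - p.2) * Real.exp p.1))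
  have hF : Integrable F (volume.prod (volume.restrict (Ioc a t))) := by
    have hFm : AEStronglyMeasurable F (volume.prod (volume.restrict (Ioc a t))) :=
      hmeas.comp_snd.mul (by fun_prop : Continuous fun p : ℝ × ℝ =>
        Real.exp (p.1 * q) * Real.exp (-(t - p.2) * Real.exp p.1)).aestronglyMeasurable
    rw [integrable_prod_iff' hFm]
    refine ⟨hlt.mono fun τ hτ =>
      (integrable_exp_mul_mul_exp_neg_mul_exp hq0 (sub_pos.2 hτ)).const_mul (g τ), ?_⟩
    refine (hint.norm.const_mul (Real.Gamma q)).congr (hlt.mono fun τ hτ => ?_)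
    have hpos := sub_pos.2 hτ
    simp only [F, norm_mul, Real.norm_eq_abs, Real.abs_exp]
    rw [integral_const_mul, integral_exp_mul_mul_exp_neg_mul_exp hq0 hpos,
      abs_of_pos (Real.rpow_pos_of_pos hpos _)]
    ring
  calc
    _ = ∫ w : ℝ, ∫ τ in Ioc a t, F (w, τ) := by
      refine integral_congr_ae (Filter.Eventually.of_forall fun w => ?_)
      simp only [F]
      rw [intervalIntegral.integral_of_le hat, ← integral_const_mul]
      congr with τ
      ring
    _ = ∫ τ in Ioc a t, ∫ w : ℝ, F (w, τ) := integral_integral_swap hF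
    _ = ∫ τ in Ioc a t, Real.Gamma q * ((t - τ) ^ (-q) * g τ) := by
      refine integral_congr_ae (hlt.mono fun τ hτ => ?_)
      simp only [F]
      rw [integral_const_mul, integral_exp_mul_mul_exp_neg_mul_exp hq0 (sub_pos.2 hτ)]
      ring
    _ = _ := by rw [integral_const_mul, intervalIntegral.integral_of_le hat]

/-- For every `t ∈ [a, a+T]` the Caputo derivative has the diffusive
representation `D_a^α y(t) = ∫_{-∞}^∞ φ^D(w, t) dw`. -/
theorem caputo_eq_integral_phiD (a T α : ℝ) (hT : 0 < T) (hα : 0 < α) (hαni : ∀ n : ℤ, α ≠ n)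
    (y : ℝ → ℝ) (hy : ContDiffOn ℝ (⌈α⌉₊ : ℕ∞) y (Set.Icc a (a + T)))
    (t : ℝ) (ht : t ∈ Set.Icc a (a + T)) :
    caputoDeriv a T α y t = ∫ w : ℝ, phiD a T α y w t := by
  have hlow : (⌊α⌋ : ℝ) < α := lt_of_le_of_ne (Int.floor_le α) (hαni _).symm
  have hceil : ⌈α⌉ = ⌊α⌋ + 1 := by
    rw [Int.ceil_eq_iff]
    push_cast
    exact ⟨by linarith, (Int.lt_floor_add_one α).le⟩
  obtain ⟨q, hq⟩ : ∃ q, q = α - ⌊α⌋ := ⟨_, rfl⟩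
  have hq0 : 0 < q := by linarith
  have hq1 : q < 1 := by linarith [Int.lt_floor_add_one α]
  have hexp : α - (⌈α⌉ : ℝ) + 1 = q := by rw [hceil, hq]; push_cast; ring
  have hnat : (⌈α⌉₊ : ℝ) - α = 1 - q := by
    rw [natCast_ceil_eq_intCast_ceil hα.le]; linarith
  have hsin : (-1 : ℝ) ^ ⌊α⌋ * Real.sin (α * π) = Real.sin (π * q) := by
    rw [show π * q = α * π - ⌊α⌋ * π by rw [hq]; ring, Real.sin_sub_int_mul_pi]
  have hg : ContinuousOn (iteratedDerivWithin ⌈α⌉₊ y (Icc a (a + T))) (Icc a t) :=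
    (hy.continuousOn_iteratedDerivWithin le_rfl
      (uniqueDiffOn_Icc (by linarith))).mono (Icc_subset_Icc_right ht.2)
  have hcoef : (-1 : ℝ) ^ ⌊α⌋ * (Real.sin (α * π) / π) * Real.Gamma q =
      1 / Real.Gamma (1 - q) := by
    have hrefl := Real.Gamma_mul_Gamma_one_sub q
    have h1 := (Real.Gamma_pos_of_pos hq0).ne'
    have h2 := (Real.Gamma_pos_of_pos (sub_pos.2 hq1)).ne'
    have hs : Real.sin (π * q) ≠ 0 := by
      intro hs
      rw [hs, div_zero] at hrefl
      exact mul_ne_zero h1 h2 hrefl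
    rw [← mul_div_assoc, hsin, eq_div_iff h2, mul_assoc, hrefl]
    field_simp
  simp only [caputoDeriv, phiD, hexp, hnat, mul_assoc _ (Real.exp _)]
  rw [integral_const_mul, integral_exp_mul_intervalIntegral ht.1 hq0 hq1 hg, ← mul_assoc, hcoef,
    show 1 - q - 1 = -q by ring]
end

section
/- Let a ∈ ℝ, T > 0, let α be a positive real number that is not an integer, and let y be ⌈α⌉ times continuously differentiable on [a, a+T]. Then for every fixed t ∈ [a, a+T], there exist constants C > 0 and W ∈ ℝ such that |φ^D(w, t)| ≤ C · e^{w·(q_D - 1)} for all w ≥ W; i.e., φ^D(w, t) = O(e^{w(q_D-1)}) as w → ∞. Since q_D < 1, the kernel decays exponentially as w → ∞. -/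
open Real MeasureTheory Set

/-- A Laplace-type bound: if `|g| ≤ M` on `[a, t]`, then `|∫_a^t g(τ) e^{-(t-τ)k} dτ| ≤ M / k`. -/
theorem abs_integral_mul_exp_le {a t M k : ℝ} {g : ℝ → ℝ} (hat : a ≤ t) (hM : 0 ≤ M)
    (hg : ∀ τ ∈ Set.Icc a t, |g τ| ≤ M) (hk : 0 < k) :
    |∫ τ in a..t, g τ * Real.exp (-(t - τ) * k)| ≤ M / k := by
  have hderiv : ∀ τ ∈ Set.uIcc a t,
      HasDerivAt (fun τ => M / k * Real.exp (-(t - τ) * k)) (M * Real.exp (-(t - τ) * k)) τ := by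
    intro τ _
    have h := (((((hasDerivAt_id τ).const_sub t).neg).mul_const k).exp).const_mul (M / k)
    refine h.congr_deriv ?_
    simp only [Pi.neg_apply, id]
    field_simp
  have hint : IntervalIntegrable (fun τ => M * Real.exp (-(t - τ) * k)) volume a t :=
    Continuous.intervalIntegrable (by fun_prop) a t
  calc |∫ τ in a..t, g τ * Real.exp (-(t - τ) * k)|
      ≤ ∫ τ in a..t, M * Real.exp (-(t - τ) * k) := by
        rw [← Real.norm_eq_abs]
        refine intervalIntegral.norm_integral_le_of_norm_le hat ?_ hint
        refine Filter.Eventually.of_forall fun τ hτ => ?_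
        rw [norm_mul, Real.norm_eq_abs, Real.norm_eq_abs, Real.abs_exp]
        exact mul_le_mul_of_nonneg_right (hg τ (Set.Ioc_subset_Icc_self hτ)) (Real.exp_pos _).le
    _ = M / k * Real.exp (-(t - t) * k) - M / k * Real.exp (-(t - a) * k) :=
        intervalIntegral.integral_eq_sub_of_hasDerivAt hderiv hint
    _ ≤ M / k := by
        have : 0 ≤ M / k * Real.exp (-(t - a) * k) := by positivity
        simpa using this

/-- For every fixed `t ∈ [a, a+T]` there are `C > 0` and `W ∈ ℝ` with
`|φ^D(w, t)| ≤ C · e^{w·(q_D - 1)}` for all `w ≥ W`; i.e. `φ^D(w, t) = O(e^{w(q_D-1)})`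
as `w → ∞` (exponential decay, since `q_D < 1`). -/
theorem phiD_decay_atTop (a T α : ℝ) (hT : 0 < T) (hα : 0 < α) (hαni : ∀ n : ℤ, α ≠ n)
    (y : ℝ → ℝ) (hy : ContDiffOn ℝ (⌈α⌉₊ : ℕ∞) y (Set.Icc a (a + T)))
    (t : ℝ) (ht : t ∈ Set.Icc a (a + T)) :
    ∃ C > 0, ∃ W : ℝ, ∀ w ≥ W,
      |phiD a T α y w t| ≤ C * Real.exp (w * ((α - (⌈α⌉ : ℝ) + 1) - 1)) := by
  obtain ⟨M, hM⟩ := isCompact_Icc.exists_bound_of_continuousOn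
    (hy.continuousOn_iteratedDerivWithin le_rfl (uniqueDiffOn_Icc (by linarith)))
  have hM0 : 0 ≤ M := (norm_nonneg _).trans (hM t ht)
  set A := (-1 : ℝ) ^ ⌊α⌋ * (Real.sin (α * π) / π) with hA
  refine ⟨|A| * M + 1, by positivity, 0, fun w _ => ?_⟩
  have hI := abs_integral_mul_exp_le ht.1 hM0
    (fun τ hτ => hM τ ⟨hτ.1, hτ.2.trans ht.2⟩) (Real.exp_pos w)
  rw [phiD, ← hA, abs_mul, abs_mul, Real.abs_exp, mul_sub, mul_one, Real.exp_sub]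
  set B := Real.exp (w * (α - (⌈α⌉ : ℝ) + 1)) with hB
  have hB0 : 0 < B := Real.exp_pos _
  calc _ ≤ |A| * B * (M / Real.exp w) := mul_le_mul_of_nonneg_left hI (by positivity)
    _ = |A| * M * (B / Real.exp w) := by ring
    _ ≤ (|A| * M + 1) * (B / Real.exp w) := by gcongr; linarith
end

section
/- Let a ∈ ℝ, T > 0, let α be a positive real number that is not an integer, and let y be ⌈α⌉ times continuously differentiable on [a, a+T]. Then for every t ∈ [a, a+T] and every w ∈ ℝ, |φ^D(w, t)| ≤ 3 · (|sin(απ)|/π) · ‖y^{(⌈α⌉-1)}‖_{L^∞[a,a+T]} · e^{w·q_D}. In particular, since q_D > 0, φ^D(w, t) = O(e^{w·q_D}) decays exponentially to zero as w → -∞. -/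
open Real MeasureTheory Set

/-- Integrating by parts, the integral of a derivative against the decaying exponential
`exp (-(t - τ) k)` is bounded by twice the supremum of the function. -/
theorem abs_integral_deriv_mul_exp_le {a t k M : ℝ} {g g' : ℝ → ℝ} (hat : a ≤ t) (hk : 0 ≤ k)
    (hg : ContinuousOn g (Set.Icc a t)) (hg' : ContinuousOn g' (Set.Icc a t))
    (hd : ∀ x ∈ Set.Ioo a t, HasDerivAt g (g' x) x) (hM : ∀ x ∈ Set.Icc a t, |g x| ≤ M) :
    |∫ τ in a..t, g' τ * Real.exp (-(t - τ) * k)| ≤ 2 * M := by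
  have he : ∀ x, HasDerivAt (fun τ => Real.exp (-(t - τ) * k))
      (Real.exp (-(t - x) * k) * k) x := by
    intro x
    have h : HasDerivAt (fun τ => -(t - τ) * k) k x := by
      simpa using (((hasDerivAt_id x).const_sub t).neg).mul_const k
    exact h.exp
  have hecont : Continuous fun τ => Real.exp (-(t - τ) * k) * k := by fun_prop
  have hi := hecont.intervalIntegrable (μ := volume) a t
  have hexp : ∫ τ in a..t, Real.exp (-(t - τ) * k) * k = 1 - Real.exp (-(t - a) * k) := by
    rw [intervalIntegral.integral_eq_sub_of_hasDerivAt (fun x _ => he x) hi]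
    simp
  have hibp : ∫ τ in a..t, g' τ * Real.exp (-(t - τ) * k) =
      g t - g a * Real.exp (-(t - a) * k)
        - ∫ τ in a..t, g τ * (Real.exp (-(t - τ) * k) * k) := by
    have h := intervalIntegral.integral_mul_deriv_eq_deriv_mul_of_hasDerivAt (a := a) (b := t)
      (u := g) (u' := g') (v := fun τ => Real.exp (-(t - τ) * k))
      (v' := fun τ => Real.exp (-(t - τ) * k) * k)
      (by rwa [uIcc_of_le hat]) (by fun_prop)
      (by rwa [min_eq_left hat, max_eq_right hat]) (fun x _ => he x)
      (by rw [← uIcc_of_le hat] at hg'; exact hg'.intervalIntegrable) hi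
    simp only [sub_self, neg_zero, zero_mul, Real.exp_zero, mul_one] at h
    linarith
  have hbound : |∫ τ in a..t, g τ * (Real.exp (-(t - τ) * k) * k)| ≤
      M * (1 - Real.exp (-(t - a) * k)) := by
    rw [← hexp, ← intervalIntegral.integral_const_mul, ← Real.norm_eq_abs]
    refine intervalIntegral.norm_integral_le_of_norm_le hat ?_ (hi.const_mul M)
    refine Filter.Eventually.of_forall fun x hx => ?_
    have hnn : 0 ≤ Real.exp (-(t - x) * k) * k := by positivity
    rw [Real.norm_eq_abs, abs_mul, abs_of_nonneg hnn]
    exact mul_le_mul_of_nonneg_right (hM x (Ioc_subset_Icc_self hx)) hnn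
  have ht := hM t (right_mem_Icc.2 hat)
  have ha : |g a * Real.exp (-(t - a) * k)| ≤ M * Real.exp (-(t - a) * k) := by
    rw [abs_mul, Real.abs_exp]
    exact mul_le_mul_of_nonneg_right (hM a (left_mem_Icc.2 hat)) (Real.exp_pos _).le
  rw [hibp, abs_le]
  rw [abs_le] at hbound ht ha
  constructor <;> linarith [hbound.1, hbound.2, ht.1, ht.2, ha.1, ha.2]

/-- For every `t ∈ [a, a+T]` and every `w ∈ ℝ`,
`|φ^D(w, t)| ≤ 3 · (|sin(απ)|/π) · ‖y^{(⌈α⌉-1)}‖_{L^∞[a,a+T]} · e^{w·q_D}`;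
in particular (as `q_D > 0`) the kernel decays exponentially to zero as `w → -∞`.
The `L^∞` norm is the supremum of `|y^{(⌈α⌉-1)}|` over `[a, a+T]`. -/
theorem phiD_decay_atBot (a T α : ℝ) (hT : 0 < T) (hα : 0 < α) (hαni : ∀ n : ℤ, α ≠ n)
    (y : ℝ → ℝ) (hy : ContDiffOn ℝ (⌈α⌉₊ : ℕ∞) y (Set.Icc a (a + T)))
    (t : ℝ) (ht : t ∈ Set.Icc a (a + T)) (w : ℝ) :
    |phiD a T α y w t| ≤
      3 * (|Real.sin (α * π)| / π) *
        sSup ((fun τ => |iteratedDerivWithin (⌈α⌉₊ - 1) y (Set.Icc a (a + T)) τ|) ''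
          Set.Icc a (a + T)) *
        Real.exp (w * (α - (⌈α⌉ : ℝ) + 1)) := by
  obtain ⟨m, hm⟩ : ∃ m, ⌈α⌉₊ = m + 1 :=
    Nat.exists_eq_succ_of_ne_zero (Nat.ceil_pos.2 hα).ne'
  have hs : UniqueDiffOn ℝ (Set.Icc a (a + T)) := uniqueDiffOn_Icc (by linarith)
  unfold phiD
  rw [hm] at hy ⊢
  rw [Nat.add_sub_cancel]
  set s := Set.Icc a (a + T)
  have hg : ContinuousOn (iteratedDerivWithin m y s) s :=
    hy.continuousOn_iteratedDerivWithin (by exact_mod_cast Nat.le_succ m) hs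
  have hg' : ContinuousOn (iteratedDerivWithin (m + 1) y s) s :=
    hy.continuousOn_iteratedDerivWithin le_rfl hs
  have hdiff : DifferentiableOn ℝ (iteratedDerivWithin m y s) s :=
    hy.differentiableOn_iteratedDerivWithin (by exact_mod_cast Nat.lt_succ_self m) hs
  have hsub : Set.Icc a t ⊆ s := Icc_subset_Icc le_rfl ht.2
  set M := sSup ((fun τ => |iteratedDerivWithin m y s τ|) '' s)
  have hM : ∀ x ∈ s, |iteratedDerivWithin m y s x| ≤ M := fun x hx =>
    le_csSup (isCompact_Icc.image_of_continuousOn hg.abs).bddAbove (mem_image_of_mem _ hx)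
  have hM0 : 0 ≤ M := (abs_nonneg _).trans (hM t ht)
  have hint := abs_integral_deriv_mul_exp_le ht.1 (Real.exp_pos w).le (hg.mono hsub)
    (hg'.mono hsub) (fun x hx => by
      have hx' : s ∈ nhds x := Icc_mem_nhds hx.1 (hx.2.trans_le ht.2)
      rw [iteratedDerivWithin_succ]
      exact (hdiff x (mem_of_mem_nhds hx')).hasDerivWithinAt.hasDerivAt hx')
    (fun x hx => hM x (hsub hx))
  rw [abs_mul, abs_mul, abs_mul, abs_zpow, abs_neg, abs_one, one_zpow, one_mul, abs_div,
    abs_of_pos Real.pi_pos, Real.abs_exp]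
  calc _ ≤ |Real.sin (α * π)| / π * Real.exp (w * (α - (⌈α⌉ : ℝ) + 1)) * (3 * M) := by
        gcongr
        linarith
    _ = _ := by ring
end

section
/- Let a ∈ ℝ, T > 0, let α be a positive real number that is not an integer, and let y be ⌈α⌉ times continuously differentiable on [a, a+T]. Let t ∈ [a, a+T] and let w > 0 be such that t - w·e^{-w} ≥ a. Then |e^{w·q_D} · ∫_{t - w·e^{-w}}^{t} y^{(⌈α⌉)}(τ) · exp(-(t-τ)·e^w) dτ| ≤ ‖y^{(⌈α⌉)}‖_{L^∞[a,a+T]} · e^{w·(q_D-1)} · (1 - e^{-w}), which in particular is at most ‖y^{(⌈α⌉)}‖_{L^∞[a,a+T]} · e^{w·(q_D-1)}. -/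
open Real MeasureTheory Set

/-- The exponential kernel with rate `c` has mass `(1 - e^{-δc}) / c` on `[t - δ, t]`. -/
theorem integral_exp_neg_sub_mul (t δ : ℝ) {c : ℝ} (hc : c ≠ 0) :
    ∫ τ in (t - δ)..t, Real.exp (-(t - τ) * c) = (1 - Real.exp (-δ * c)) / c := by
  have hderiv : ∀ τ ∈ Set.uIcc (t - δ) t,
      HasDerivAt (fun τ => Real.exp (-(t - τ) * c) / c) (Real.exp (-(t - τ) * c)) τ := by
    intro τ _
    have h := ((((hasDerivAt_id τ).const_sub t).neg.mul_const c).exp).div_const c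
    refine h.congr_deriv ?_
    simp only [Pi.neg_apply, id_eq]
    field_simp
  rw [intervalIntegral.integral_eq_sub_of_hasDerivAt hderiv
    (Continuous.intervalIntegrable (by fun_prop) _ _)]
  simp only [sub_self, neg_zero, zero_mul, Real.exp_zero, sub_sub_cancel]
  ring

/-- A function bounded by `M` on `[t - δ, t]`, integrated against the exponential kernel. -/
theorem abs_integral_mul_exp_le_s6 {f : ℝ → ℝ} {M t δ c : ℝ} (hδ : 0 ≤ δ) (hc : c ≠ 0)
    (hf : ∀ τ ∈ Set.Icc (t - δ) t, |f τ| ≤ M) :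
    |∫ τ in (t - δ)..t, f τ * Real.exp (-(t - τ) * c)| ≤ M * ((1 - Real.exp (-δ * c)) / c) := by
  rw [← integral_exp_neg_sub_mul t δ hc, ← intervalIntegral.integral_const_mul,
    ← Real.norm_eq_abs]
  refine intervalIntegral.norm_integral_le_of_norm_le (by linarith)
    (Filter.Eventually.of_forall fun τ hτ => ?_)
    (Continuous.intervalIntegrable (by fun_prop) _ _)
  rw [Real.norm_eq_abs, abs_mul, Real.abs_exp]
  exact mul_le_mul_of_nonneg_right (hf τ (Set.Ioc_subset_Icc_self hτ)) (Real.exp_pos _).le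

/-- For `t ∈ [a, a+T]` and `w > 0` with `t - w·e^{-w} ≥ a`, the "recent
history" part `I₁` of the integral defining `φ^D` satisfies
`|e^{w·q_D} · ∫_{t-w·e^{-w}}^{t} y^{(⌈α⌉)}(τ) e^{-(t-τ)e^w} dτ|
  ≤ ‖y^{(⌈α⌉)}‖_{L^∞[a,a+T]} · e^{w(q_D-1)} · (1 - e^{-w}) ≤ ‖y^{(⌈α⌉)}‖_{L^∞} · e^{w(q_D-1)}`,
where `q_D = α - ⌈α⌉ + 1` and the `L^∞` norm is the sup of the absolute value on `[a, a+T]`. -/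
theorem I1_bound (a T α : ℝ) (hT : 0 < T) (hα : 0 < α) (hαni : ∀ n : ℤ, α ≠ n)
    (y : ℝ → ℝ) (hy : ContDiffOn ℝ (⌈α⌉₊ : ℕ∞) y (Set.Icc a (a + T)))
    (t : ℝ) (ht : t ∈ Set.Icc a (a + T)) (w : ℝ) (hw : 0 < w)
    (hwa : a ≤ t - w * Real.exp (-w)) :
    |Real.exp (w * (α - (⌈α⌉ : ℝ) + 1)) *
        ∫ τ in (t - w * Real.exp (-w))..t,
          iteratedDerivWithin ⌈α⌉₊ y (Set.Icc a (a + T)) τ * Real.exp (-(t - τ) * Real.exp w)| ≤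
      sSup ((fun τ => |iteratedDerivWithin ⌈α⌉₊ y (Set.Icc a (a + T)) τ|) '' Set.Icc a (a + T)) *
        Real.exp (w * ((α - (⌈α⌉ : ℝ) + 1) - 1)) * (1 - Real.exp (-w)) ∧
    sSup ((fun τ => |iteratedDerivWithin ⌈α⌉₊ y (Set.Icc a (a + T)) τ|) '' Set.Icc a (a + T)) *
        Real.exp (w * ((α - (⌈α⌉ : ℝ) + 1) - 1)) * (1 - Real.exp (-w)) ≤
      sSup ((fun τ => |iteratedDerivWithin ⌈α⌉₊ y (Set.Icc a (a + T)) τ|) '' Set.Icc a (a + T)) *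
        Real.exp (w * ((α - (⌈α⌉ : ℝ) + 1) - 1)) := by
  set g := iteratedDerivWithin ⌈α⌉₊ y (Set.Icc a (a + T))
  set q := α - (⌈α⌉ : ℝ) + 1
  set M := sSup ((fun τ => |g τ|) '' Set.Icc a (a + T))
  have hcont : ContinuousOn g (Set.Icc a (a + T)) :=
    hy.continuousOn_iteratedDerivWithin le_rfl (uniqueDiffOn_Icc (by linarith))
  have hbdd : BddAbove ((fun τ => |g τ|) '' Set.Icc a (a + T)) :=
    isCompact_Icc.bddAbove_image hcont.abs
  have hle : ∀ τ ∈ Set.Icc a (a + T), |g τ| ≤ M := fun τ hτ =>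
    le_csSup hbdd (Set.mem_image_of_mem _ hτ)
  have hM0 : 0 ≤ M := (abs_nonneg _).trans (hle t ht)
  constructor
  · have hδ : 0 ≤ w * Real.exp (-w) := by positivity
    have key := abs_integral_mul_exp_le_s6 (c := Real.exp w) hδ (Real.exp_pos w).ne'
      fun τ hτ => hle τ ⟨hwa.trans hτ.1, hτ.2.trans ht.2⟩
    have hexp : -(w * Real.exp (-w)) * Real.exp w = -w := by
      rw [neg_mul, mul_assoc, ← Real.exp_add, neg_add_cancel, Real.exp_zero, mul_one]
    rw [hexp] at key
    rw [abs_mul, Real.abs_exp]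
    refine (mul_le_mul_of_nonneg_left key (Real.exp_pos _).le).trans_eq ?_
    rw [mul_sub_one w q, Real.exp_sub]
    ring
  · exact mul_le_of_le_one_right (by positivity) (by linarith [Real.exp_pos (-w)])
end

section
/- Let a ∈ ℝ, T > 0, let α be a positive real number that is not an integer with m = ⌈α⌉, and let y be m times continuously differentiable on [a, a+T]. Then for every t ∈ [a, a+T], the Caputo derivative admits the double-integral representation D_a^α y(t) = (-1)^⌊α⌋ · (sin(απ)/π) · ∫_a^t ∫_0^∞ (e^{-z}/z) · (z/(t-τ))^{q_D} · y^{(m)}(τ) dz dτ. -/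
open Real MeasureTheory Set

/-- The inner integral of the double-integral representation is a Gamma integral. -/
theorem integral_Ioi_exp_neg_div_mul_div_rpow {q s : ℝ} (hq : 0 < q) (hs : 0 ≤ s) (c : ℝ) :
    ∫ z in Set.Ioi (0 : ℝ), (Real.exp (-z) / z) * (z / s) ^ q * c =
      Real.Gamma q * (s ^ (-q) * c) := by
  rw [Real.Gamma_eq_integral hq, ← integral_mul_const]
  refine setIntegral_congr_fun measurableSet_Ioi fun z hz => ?_
  have hz : 0 < z := hz
  simp only [Real.div_rpow hz.le hs, Real.rpow_neg hs, Real.rpow_sub_one hz.ne']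
  ring

/-- The reflection formula at the fractional part of a non-integer `α`. -/
theorem one_div_Gamma_one_sub_sub_floor {α : ℝ} (hα : 0 < α - ⌊α⌋) (hα' : α - ⌊α⌋ < 1) :
    1 / Real.Gamma (1 - (α - ⌊α⌋)) =
      (-1 : ℝ) ^ ⌊α⌋ * (Real.sin (α * π) / π) * Real.Gamma (α - ⌊α⌋) := by
  have h := Real.Gamma_mul_Gamma_one_sub (α - ⌊α⌋)
  have hpos : 0 < Real.Gamma (1 - (α - ⌊α⌋)) := Real.Gamma_pos_of_pos (by linarith)
  have hsin : Real.sin (π * (α - ⌊α⌋)) = (-1 : ℝ) ^ ⌊α⌋ * Real.sin (α * π) := by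
    rw [← Real.sin_sub_int_mul_pi]
    congr 1
    ring
  have hsin_pos : 0 < Real.sin (π * (α - ⌊α⌋)) :=
    Real.sin_pos_of_pos_of_lt_pi (by positivity) (by nlinarith [Real.pi_pos])
  have hpi := Real.pi_pos
  rw [← mul_div_assoc, ← hsin, div_eq_iff hpos.ne', mul_assoc, h]
  field_simp

/-- For every `t ∈ [a, a+T]`, the Caputo derivative has the
double-integral representation
`D_a^α y(t) = (-1)^⌊α⌋ · (sin(απ)/π) · ∫_a^t ∫_0^∞ (e^{-z}/z) · (z/(t-τ))^{q_D} · y^{(m)}(τ) dz dτ`,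
where `m = ⌈α⌉` and `q_D = α - ⌈α⌉ + 1`. -/
theorem caputo_double_integral_rep (a T α : ℝ) (hT : 0 < T) (hα : 0 < α)
    (hαni : ∀ n : ℤ, α ≠ n)
    (y : ℝ → ℝ) (hy : ContDiffOn ℝ (⌈α⌉₊ : ℕ∞) y (Set.Icc a (a + T)))
    (t : ℝ) (ht : t ∈ Set.Icc a (a + T)) :
    caputoDeriv a T α y t =
      (-1 : ℝ) ^ ⌊α⌋ * (Real.sin (α * π) / π) *
        ∫ τ in a..t, ∫ z in Set.Ioi (0 : ℝ),
          (Real.exp (-z) / z) * (z / (t - τ)) ^ (α - (⌈α⌉ : ℝ) + 1) *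
            iteratedDerivWithin ⌈α⌉₊ y (Set.Icc a (a + T)) τ := by
  have hfloor : (⌊α⌋ : ℝ) < α := lt_of_le_of_ne (Int.floor_le α) fun h => hαni _ h.symm
  have hlt : α < ⌊α⌋ + 1 := Int.lt_floor_add_one α
  have hceil : ⌈α⌉ = ⌊α⌋ + 1 := by
    rw [Int.ceil_eq_iff]
    push_cast
    exact ⟨by linarith, hlt.le⟩
  have hnat : (⌈α⌉₊ : ℝ) = ⌊α⌋ + 1 := by
    rw [natCast_ceil_eq_intCast_ceil hα.le, hceil]
    push_cast
    rfl
  have hinner : ∀ τ ∈ Set.uIcc a t, (∫ z in Set.Ioi (0 : ℝ),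
      (Real.exp (-z) / z) * (z / (t - τ)) ^ (α - (⌈α⌉ : ℝ) + 1) *
        iteratedDerivWithin ⌈α⌉₊ y (Set.Icc a (a + T)) τ) =
      Real.Gamma (α - ⌊α⌋) * ((t - τ) ^ ((⌈α⌉₊ : ℝ) - α - 1) *
        iteratedDerivWithin ⌈α⌉₊ y (Set.Icc a (a + T)) τ) := by
    intro τ hτ
    rw [Set.uIcc_of_le ht.1] at hτ
    have hq : α - (⌈α⌉ : ℝ) + 1 = α - ⌊α⌋ := by
      rw [hceil]
      push_cast
      ring
    rw [hq, integral_Ioi_exp_neg_div_mul_div_rpow (sub_pos.2 hfloor) (sub_nonneg.2 hτ.2),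
      show (⌈α⌉₊ : ℝ) - α - 1 = -(α - ⌊α⌋) by rw [hnat]; ring]
  rw [intervalIntegral.integral_congr hinner, intervalIntegral.integral_const_mul, ← mul_assoc,
    ← one_div_Gamma_one_sub_sub_floor (sub_pos.2 hfloor) (by linarith), caputoDeriv,
    show (⌈α⌉₊ : ℝ) - α = 1 - (α - ⌊α⌋) by rw [hnat]; ring]
end

section
/- Let a ∈ ℝ, T > 0, let α be a positive real number that is not an integer, and let y be ⌈α⌉ times continuously differentiable on [a, a+T]. Then for every t ∈ [a, a+T], the Caputo derivative satisfies D_a^α y(t) = ∫_0^∞ e^{-u} · φ̂^D(u, t) du, where φ̂^D(u, t) = e^u · ( (1/q_D) · φ^D(-u/q_D, t) + (1/(1-q_D)) · φ^D(u/(1-q_D), t) ). -/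
open Real MeasureTheory Set

/-- The rescaled kernel
`φ̂^D(u, t) = e^u · ((1/q_D)·φ^D(-u/q_D, t) + (1/(1-q_D))·φ^D(u/(1-q_D), t))`. -/
noncomputable def phiDhat (a T α : ℝ) (y : ℝ → ℝ) (u t : ℝ) : ℝ :=
  Real.exp u *
    ((1 / (α - (⌈α⌉ : ℝ) + 1)) * phiD a T α y (-u / (α - (⌈α⌉ : ℝ) + 1)) t +
     (1 / (1 - (α - (⌈α⌉ : ℝ) + 1))) * phiD a T α y (u / (1 - (α - (⌈α⌉ : ℝ) + 1))) t)

theorem integrable_exp_mul_exp_neg_mul_exp {q r : ℝ} (hq : 0 < q) (hr : 0 < r) :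
    Integrable (fun w : ℝ => Real.exp (w * q) * Real.exp (-r * Real.exp w)) := by
  have h : IntegrableOn (fun s : ℝ => s ^ (q - 1) * Real.exp (-r * s)) (Real.exp '' univ) := by
    rw [image_univ, Real.range_exp]
    simpa using integrableOn_rpow_mul_exp_neg_mul_rpow (s := q - 1) (p := 1) (by linarith)
      one_pos hr
  rw [integrableOn_image_iff_integrableOn_abs_deriv_smul MeasurableSet.univ
    (fun x _ => (Real.hasDerivAt_exp x).hasDerivWithinAt) Real.exp_injective.injOn,
    integrableOn_univ] at h
  refine h.congr (Filter.Eventually.of_forall fun w => ?_)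
  simp only [smul_eq_mul, Real.abs_exp, ← Real.exp_mul, ← Real.exp_add]
  ring_nf

theorem integral_exp_mul_exp_neg_mul_exp {q r : ℝ} (hq : 0 < q) (hr : 0 < r) :
    ∫ w : ℝ, Real.exp (w * q) * Real.exp (-r * Real.exp w) = r ^ (-q) * Real.Gamma q := by
  have h := integral_image_eq_integral_abs_deriv_smul MeasurableSet.univ
    (fun x _ => (Real.hasDerivAt_exp x).hasDerivWithinAt) Real.exp_injective.injOn
    (fun s : ℝ => s ^ (q - 1) * Real.exp (-(r * s)))
  rw [image_univ, Real.range_exp, Real.integral_rpow_mul_exp_neg_mul_Ioi hq hr,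
    setIntegral_univ] at h
  rw [Real.rpow_neg hr.le, ← Real.inv_rpow hr.le, inv_eq_one_div, h]
  refine integral_congr_ae (Filter.Eventually.of_forall fun w => ?_)
  simp only [smul_eq_mul, Real.abs_exp, ← Real.exp_mul, ← Real.exp_add]
  ring_nf

/-- The integrand of the diffusive representation is integrable jointly in both variables. -/
theorem integrable_diffusive_kernel {a t q : ℝ} (hat : a ≤ t) (hq0 : 0 < q) (hq1 : q < 1)
    {f : ℝ → ℝ} (hf : ContinuousOn f (Icc a t)) :
    Integrable (fun p : ℝ × ℝ =>
        f p.1 * (Real.exp (p.2 * q) * Real.exp (-(t - p.1) * Real.exp p.2)))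
      ((volume.restrict (Ioo a t)).prod volume) := by
  have hmeas : AEStronglyMeasurable (fun p : ℝ × ℝ =>
      f p.1 * (Real.exp (p.2 * q) * Real.exp (-(t - p.1) * Real.exp p.2)))
      ((volume.restrict (Ioo a t)).prod volume) := by
    refine AEStronglyMeasurable.mul ?_ (Continuous.aestronglyMeasurable (by fun_prop))
    exact ((hf.mono Ioo_subset_Icc_self).aestronglyMeasurable measurableSet_Ioo).comp_fst
  rw [integrable_prod_iff hmeas]
  constructor
  · refine (ae_restrict_iff' measurableSet_Ioo).2 (Filter.Eventually.of_forall fun τ hτ => ?_)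
    exact (integrable_exp_mul_exp_neg_mul_exp hq0 (sub_pos.2 hτ.2)).const_mul (f τ)
  · have hpow : IntervalIntegrable (fun τ : ℝ => (t - τ) ^ (-q)) volume a t := by
      have := (intervalIntegral.intervalIntegrable_rpow' (a := t - a) (b := 0)
        (r := -q) (by linarith)).comp_sub_left t
      simpa using this
    have hint : IntervalIntegrable (fun τ : ℝ => |f τ| * (t - τ) ^ (-q)) volume a t :=
      hpow.continuousOn_mul (by rw [uIcc_of_le hat]; exact hf.abs)
    have hint' : IntegrableOn (fun τ : ℝ => |f τ| * (t - τ) ^ (-q) * Real.Gamma q) (Ioo a t) :=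
      (((intervalIntegrable_iff_integrableOn_Ioo_of_le hat).1 hint).mul_const _)
    refine hint'.congr ((ae_restrict_iff' measurableSet_Ioo).2
      (Filter.Eventually.of_forall fun τ hτ => ?_))
    simp only [norm_mul, Real.norm_eq_abs, Real.abs_exp]
    rw [integral_const_mul, integral_exp_mul_exp_neg_mul_exp hq0 (sub_pos.2 hτ.2), mul_assoc]

theorem integrable_exp_mul_integral {a t q : ℝ} (hat : a ≤ t) (hq0 : 0 < q) (hq1 : q < 1)
    {f : ℝ → ℝ} (hf : ContinuousOn f (Icc a t)) :
    Integrable (fun w : ℝ =>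
      Real.exp (w * q) * ∫ τ in a..t, f τ * Real.exp (-(t - τ) * Real.exp w)) := by
  refine (integrable_diffusive_kernel hat hq0 hq1 hf).integral_prod_right.congr
    (Filter.Eventually.of_forall fun w => ?_)
  simp only [intervalIntegral.integral_of_le hat, integral_Ioc_eq_integral_Ioo,
    ← integral_const_mul]
  congr 1 with τ
  ring

theorem integral_exp_mul_integral {a t q : ℝ} (hat : a ≤ t) (hq0 : 0 < q) (hq1 : q < 1)
    {f : ℝ → ℝ} (hf : ContinuousOn f (Icc a t)) :
    ∫ w : ℝ, Real.exp (w * q) * ∫ τ in a..t, f τ * Real.exp (-(t - τ) * Real.exp w) =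
      Real.Gamma q * ∫ τ in a..t, (t - τ) ^ (-q) * f τ := by
  have hswap := integral_integral_swap
    (f := fun τ w => f τ * (Real.exp (w * q) * Real.exp (-(t - τ) * Real.exp w)))
    (integrable_diffusive_kernel hat hq0 hq1 hf)
  calc
    _ = ∫ w : ℝ, ∫ τ in Ioo a t,
          f τ * (Real.exp (w * q) * Real.exp (-(t - τ) * Real.exp w)) := by
      simp only [intervalIntegral.integral_of_le hat, integral_Ioc_eq_integral_Ioo,
        ← integral_const_mul]
      congr 1 with w
      congr 1 with τ
      ring
    _ = _ := by
      rw [← hswap, intervalIntegral.integral_of_le hat, integral_Ioc_eq_integral_Ioo,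
        ← integral_const_mul]
      refine setIntegral_congr_fun measurableSet_Ioo fun τ hτ => ?_
      rw [integral_const_mul, integral_exp_mul_exp_neg_mul_exp hq0 (sub_pos.2 hτ.2)]
      ring

/-- An integral over `ℝ` as an integral over `(0, ∞)`, with independent rescalings of the two
half-lines. -/
theorem integral_Ioi_rescale_add_rescale {g : ℝ → ℝ} (hg : Integrable g) {b c : ℝ}
    (hb : 0 < b) (hc : 0 < c) :
    ∫ u in Ioi (0 : ℝ), ((1 / b) * g (-u / b) + (1 / c) * g (u / c)) = ∫ w, g w := by
  have hleft : ∀ u, g (-u / b) = (fun v => g (-v)) (b⁻¹ * u) := fun u => by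
    simp only; congr 1; ring
  have hright : ∀ u, g (u / c) = g (c⁻¹ * u) := fun u => by congr 1; ring
  simp only [hleft, hright]
  have h₁ : IntegrableOn (fun u => (fun v => g (-v)) (b⁻¹ * u)) (Ioi 0) := by
    rw [integrableOn_Ioi_comp_mul_left_iff (fun v => g (-v)) _ (inv_pos.2 hb)]
    exact hg.comp_neg.integrableOn
  have h₂ : IntegrableOn (fun u => g (c⁻¹ * u)) (Ioi 0) := by
    rw [integrableOn_Ioi_comp_mul_left_iff g _ (inv_pos.2 hc)]
    exact hg.integrableOn
  rw [integral_add (h₁.const_mul _) (h₂.const_mul _), integral_const_mul, integral_const_mul,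
    integral_comp_mul_left_Ioi (fun v => g (-v)) _ (inv_pos.2 hb),
    integral_comp_mul_left_Ioi g _ (inv_pos.2 hc),
    mul_zero, mul_zero, integral_comp_neg_Ioi, neg_zero, smul_eq_mul, smul_eq_mul, inv_inv,
    inv_inv, ← mul_assoc, ← mul_assoc, one_div_mul_cancel hb.ne', one_div_mul_cancel hc.ne',
    one_mul, one_mul, intervalIntegral.integral_Iic_add_Ioi hg.integrableOn hg.integrableOn]

/-- For every `t ∈ [a, a+T]`,
`D_a^α y(t) = ∫_0^∞ e^{-u} · φ̂^D(u, t) du`. -/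
theorem caputo_eq_integral_phiDhat (a T α : ℝ) (hT : 0 < T) (hα : 0 < α)
    (hαni : ∀ n : ℤ, α ≠ n)
    (y : ℝ → ℝ) (hy : ContDiffOn ℝ (⌈α⌉₊ : ℕ∞) y (Set.Icc a (a + T)))
    (t : ℝ) (ht : t ∈ Set.Icc a (a + T)) :
    caputoDeriv a T α y t = ∫ u in Set.Ioi (0 : ℝ), Real.exp (-u) * phiDhat a T α y u t := by
  have hfloor : (⌊α⌋ : ℝ) < α := lt_of_le_of_ne (Int.floor_le α) (hαni _).symm
  have hceil : ⌈α⌉ = ⌊α⌋ + 1 :=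
    Int.ceil_eq_iff.2 ⟨by push_cast; linarith, by push_cast; exact (Int.lt_floor_add_one α).le⟩
  have hnat : ((⌈α⌉₊ : ℕ) : ℝ) = (⌈α⌉ : ℝ) := natCast_ceil_eq_intCast_ceil hα.le
  obtain ⟨q, hq⟩ : ∃ q, q = α - (⌈α⌉ : ℝ) + 1 := ⟨_, rfl⟩
  have hq' : α = q + ⌊α⌋ := by rw [hq, hceil]; push_cast; ring
  have hq0 : 0 < q := by linarith
  have hq1 : q < 1 := by linarith [Int.lt_floor_add_one α]
  have hf : ContinuousOn (iteratedDerivWithin ⌈α⌉₊ y (Icc a (a + T))) (Icc a t) :=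
    (hy.continuousOn_iteratedDerivWithin le_rfl (uniqueDiffOn_Icc (by linarith))).mono
      (Icc_subset_Icc_right ht.2)
  have hsign : (-1 : ℝ) ^ ⌊α⌋ * (Real.sin (α * π) / π) = Real.sin (π * q) / π := by
    have hsin : Real.sin (α * π) = (-1) ^ ⌊α⌋ * Real.sin (π * q) := by
      rw [← Real.sin_add_int_mul_pi]
      congr 1
      linear_combination π * hq'
    rw [hsin, mul_div_assoc, ← mul_assoc, ← mul_zpow]
    norm_num
  have hphi : ∀ w, phiD a T α y w t = Real.sin (π * q) / π * (Real.exp (w * q) *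
      ∫ τ in a..t, iteratedDerivWithin ⌈α⌉₊ y (Icc a (a + T)) τ *
        Real.exp (-(t - τ) * Real.exp w)) := fun w => by
    rw [phiD, hsign, ← hq, mul_assoc]
  have hint : Integrable (fun w => phiD a T α y w t) := by
    simp only [hphi]
    exact (integrable_exp_mul_integral ht.1 hq0 hq1 hf).const_mul _
  have hcancel : ∀ u, Real.exp (-u) * phiDhat a T α y u t =
      (1 / q) * phiD a T α y (-u / q) t + (1 / (1 - q)) * phiD a T α y (u / (1 - q)) t :=
    fun u => by
      rw [phiDhat, ← hq, ← mul_assoc, ← Real.exp_add, neg_add_cancel, Real.exp_zero, one_mul]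
  simp only [hcancel]
  rw [integral_Ioi_rescale_add_rescale hint hq0 (sub_pos.2 hq1)]
  simp only [hphi]
  rw [integral_const_mul, integral_exp_mul_integral ht.1 hq0 hq1 hf, caputoDeriv, hnat,
    show (⌈α⌉ : ℝ) - α = 1 - q by rw [hq]; ring, show 1 - q - 1 = -q by ring, ← mul_assoc]
  congr 1
  have hΓ := Real.Gamma_mul_Gamma_one_sub q
  have hΓ' : Real.Gamma (1 - q) ≠ 0 := (Real.Gamma_pos_of_pos (sub_pos.2 hq1)).ne'
  have hs : Real.sin (π * q) ≠ 0 :=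
    (Real.sin_pos_of_pos_of_lt_pi (by positivity) (by nlinarith [Real.pi_pos])).ne'
  rw [eq_div_iff hs] at hΓ
  rw [div_mul_eq_mul_div, div_eq_div_iff hΓ' Real.pi_ne_zero, one_mul]
  linarith
end

section
/- Let a ∈ ℝ, T > 0, let α be a positive real number that is not an integer with m = ⌈α⌉, let y be m times continuously differentiable on [a, a+T], and fix t ∈ (a, a+T]. Then lim_{w → ∞} w^{-q_YA} · φ^YA(w, t) = (-1)^⌊α⌋ · (2·sin(απ)/π) · y^{(m)}(t), where q_YA = 2α - 2⌈α⌉ - 1. In particular, if y^{(m)}(t) ≠ 0, then φ^YA(w, t) = c^YA · w^{q_YA} · (1 + o(1)) as w → ∞ with the nonzero constant c^YA = (-1)^⌊α⌋ · (2·sin(απ)/π) · y^{(m)}(t). -/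
open Real MeasureTheory Set Filter Asymptotics

/-- The Yuan–Agrawal kernel (with `m = ⌈α⌉`):
`φ^YA(w, t) = (-1)^⌊α⌋ · (2·sin(απ)/π) · w^{2α-2⌈α⌉+1} · ∫_a^t y^{(m)}(τ) · exp(-(t-τ)·w²) dτ`. -/
noncomputable def phiYA (a T α : ℝ) (y : ℝ → ℝ) (w t : ℝ) : ℝ :=
  (-1 : ℝ) ^ ⌊α⌋ * (2 * Real.sin (α * π) / π) * w ^ (2 * α - 2 * (⌈α⌉ : ℝ) + 1) *
    ∫ τ in a..t, iteratedDerivWithin ⌈α⌉₊ y (Set.Icc a (a + T)) τ *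
      Real.exp (-(t - τ) * w ^ 2)

/-- The exponential weights `s · exp (-(t - τ) s)` integrate to `1 - exp (-(t - a) s)`. -/
lemma integral_exp_peak (a t s : ℝ) :
    ∫ τ in a..t, s * Real.exp (-(t - τ) * s) = 1 - Real.exp (-(t - a) * s) := by
  have hd : ∀ τ ∈ Set.uIcc a t, HasDerivAt (fun τ => Real.exp (-(t - τ) * s))
      (s * Real.exp (-(t - τ) * s)) τ := by
    intro τ _
    have h : HasDerivAt (fun τ : ℝ => -(t - τ) * s) s τ := by
      simpa using (((hasDerivAt_id τ).const_sub t).neg).mul_const s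
    simpa [mul_comm] using h.exp
  rw [intervalIntegral.integral_eq_sub_of_hasDerivAt hd
    (Continuous.intervalIntegrable (by fun_prop) _ _)]
  simp

/-- Exponential weights concentrate at the right endpoint of the interval of integration. -/
lemma tendsto_mul_integral_exp_peak {a t : ℝ} (hat : a < t) {g : ℝ → ℝ}
    (hg : ContinuousOn g (Set.Icc a t)) :
    Tendsto (fun s : ℝ => s * ∫ τ in a..t, g τ * Real.exp (-(t - τ) * s)) atTop (nhds (g t)) := by
  have key : Tendsto (fun s : ℝ => ∫ τ in Set.Ioc a t, (s * Real.exp (-(t - τ) * s)) • g τ)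
      atTop (nhds (g t)) := by
    refine tendsto_setIntegral_peak_smul_of_integrableOn_of_tendsto (x₀ := t)
      measurableSet_Ioc measurableSet_Ioc subset_rfl self_mem_nhdsWithin
      (by simp [Real.volume_Ioc]) ?_ ?_ ?_ ?_ ?_ ?_
    · filter_upwards [eventually_ge_atTop 0] with s hs τ _
      positivity
    · intro u hu htu
      obtain ⟨δ, hδ, hball⟩ := Metric.isOpen_iff.1 hu t htu
      have hlim : Tendsto (fun s : ℝ => s * Real.exp (-δ * s)) atTop (nhds 0) := by
        simpa using tendsto_rpow_mul_exp_neg_mul_atTop_nhds_zero 1 δ hδ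
      rw [Metric.tendstoUniformlyOn_iff]
      intro ε hε
      filter_upwards [hlim.eventually_lt_const hε, eventually_ge_atTop 0] with s hs hs0 τ hτ
      have hδτ : δ ≤ t - τ := by
        by_contra! h
        refine hτ.2 (hball ?_)
        rw [Metric.mem_ball, Real.dist_eq, abs_sub_comm, abs_of_nonneg (sub_nonneg.2 hτ.1.2)]
        exact h
      rw [Pi.zero_apply, dist_zero_left, Real.norm_of_nonneg (by positivity)]
      refine lt_of_le_of_lt ?_ hs
      gcongr
    · have hlim : Tendsto (fun s : ℝ => 1 - Real.exp (-(t - a) * s)) atTop (nhds 1) := by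
        have h := tendsto_rpow_mul_exp_neg_mul_atTop_nhds_zero 0 (t - a) (sub_pos.2 hat)
        simpa using h.const_sub 1
      refine hlim.congr fun s => ?_
      rw [← intervalIntegral.integral_of_le hat.le, integral_exp_peak]
    · exact .of_forall fun s => Continuous.aestronglyMeasurable (by fun_prop)
    · exact hg.integrableOn_Icc.mono_set Set.Ioc_subset_Icc_self
    · exact (hg t (Set.right_mem_Icc.2 hat.le)).mono Set.Ioc_subset_Icc_self
  refine key.congr fun s => ?_
  rw [intervalIntegral.integral_of_le hat.le, ← integral_const_mul]
  congr 1 with τ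
  rw [smul_eq_mul]
  ring

/-- For fixed `t ∈ (a, a+T]`, with `q_YA = 2α - 2⌈α⌉ - 1`,
`lim_{w→∞} w^{-q_YA} · φ^YA(w, t) = (-1)^⌊α⌋ · (2·sin(απ)/π) · y^{(m)}(t) =: c^YA`;
in particular, if `y^{(m)}(t) ≠ 0` then `φ^YA(w, t) = c^YA · w^{q_YA} · (1 + o(1))`
as `w → ∞`, and `c^YA ≠ 0`. -/
theorem phiYA_asymptotics (a T α : ℝ) (hT : 0 < T) (hα : 0 < α) (hαni : ∀ n : ℤ, α ≠ n)
    (y : ℝ → ℝ) (hy : ContDiffOn ℝ (⌈α⌉₊ : ℕ∞) y (Set.Icc a (a + T)))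
    (t : ℝ) (ht : t ∈ Set.Ioc a (a + T)) :
    Tendsto (fun w : ℝ => w ^ (-(2 * α - 2 * (⌈α⌉ : ℝ) - 1)) * phiYA a T α y w t) atTop
      (nhds ((-1 : ℝ) ^ ⌊α⌋ * (2 * Real.sin (α * π) / π) *
        iteratedDerivWithin ⌈α⌉₊ y (Set.Icc a (a + T)) t)) ∧
    (iteratedDerivWithin ⌈α⌉₊ y (Set.Icc a (a + T)) t ≠ 0 →
      (fun w : ℝ => phiYA a T α y w t) ~[atTop]
        (fun w : ℝ => ((-1 : ℝ) ^ ⌊α⌋ * (2 * Real.sin (α * π) / π) *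
          iteratedDerivWithin ⌈α⌉₊ y (Set.Icc a (a + T)) t) *
            w ^ (2 * α - 2 * (⌈α⌉ : ℝ) - 1)) ∧
      (-1 : ℝ) ^ ⌊α⌋ * (2 * Real.sin (α * π) / π) *
        iteratedDerivWithin ⌈α⌉₊ y (Set.Icc a (a + T)) t ≠ 0) := by
  have hsin : Real.sin (α * π) ≠ 0 := by
    rw [Real.sin_ne_zero_iff]
    intro n hn
    exact hαni n (mul_right_cancel₀ Real.pi_ne_zero hn.symm)
  have hy' : ContinuousOn (iteratedDerivWithin ⌈α⌉₊ y (Set.Icc a (a + T)))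
      (Set.Icc a (a + T)) :=
    hy.continuousOn_iteratedDerivWithin le_rfl (uniqueDiffOn_Icc (by linarith))
  have hlim := (tendsto_mul_integral_exp_peak ht.1
    (hy'.mono (Set.Icc_subset_Icc_right ht.2))).comp (tendsto_pow_atTop (α := ℝ) two_ne_zero)
  have hmain : Tendsto (fun w : ℝ => w ^ (-(2 * α - 2 * (⌈α⌉ : ℝ) - 1)) * phiYA a T α y w t) atTop
      (nhds ((-1 : ℝ) ^ ⌊α⌋ * (2 * Real.sin (α * π) / π) *
        iteratedDerivWithin ⌈α⌉₊ y (Set.Icc a (a + T)) t)) := by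
    refine (hlim.const_mul _).congr' ?_
    filter_upwards [eventually_gt_atTop 0] with w hw
    have hpow : w ^ 2 = w ^ (-(2 * α - 2 * (⌈α⌉ : ℝ) - 1)) *
        w ^ (2 * α - 2 * (⌈α⌉ : ℝ) + 1) := by
      rw [← Real.rpow_add hw, ← Real.rpow_natCast]
      congr 1
      push_cast
      ring
    simp only [Function.comp_apply, phiYA]
    generalize (∫ τ in a..t, iteratedDerivWithin ⌈α⌉₊ y (Set.Icc a (a + T)) τ *
      Real.exp (-(t - τ) * w ^ 2)) = I
    rw [hpow]
    ring
  refine ⟨hmain, fun hne => ?_⟩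
  have hc : (-1 : ℝ) ^ ⌊α⌋ * (2 * Real.sin (α * π) / π) *
      iteratedDerivWithin ⌈α⌉₊ y (Set.Icc a (a + T)) t ≠ 0 := by
    refine mul_ne_zero (mul_ne_zero (zpow_ne_zero _ (by norm_num)) ?_) hne
    exact div_ne_zero (mul_ne_zero two_ne_zero hsin) Real.pi_ne_zero
  refine ⟨?_, hc⟩
  have hequiv := ((isEquivalent_const_iff_tendsto hc).2 hmain).mul
    (IsEquivalent.refl (u := fun w : ℝ => w ^ (2 * α - 2 * (⌈α⌉ : ℝ) - 1)))
  refine hequiv.congr_left ?_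
  filter_upwards [eventually_gt_atTop 0] with w hw
  rw [Pi.mul_apply, mul_right_comm, ← Real.rpow_add hw, neg_add_cancel, Real.rpow_zero, one_mul]
end

section
/- Let a ∈ ℝ, T > 0, let α be a positive real number that is not an integer with m = ⌈α⌉, let y be m times continuously differentiable on [a, a+T], and fix t ∈ (a, a+T]. Then lim_{w → ∞} w^{1/q_D} · φ^C(w, t) = (-1)^⌊α⌋ · (sin(απ)/(π·q_D)) · y^{(m)}(t), where q_D = α - ⌈α⌉ + 1. In particular, if y^{(m)}(t) ≠ 0, then φ^C(w, t) = c^C · w^{-1/q_D} · (1 + o(1)) as w → ∞ with the nonzero constant c^C = (-1)^⌊α⌋ · (sin(απ)/(π·q_D)) · y^{(m)}(t). -/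
open Real MeasureTheory Set Filter Asymptotics

/-- The Chatterjee kernel (with `m = ⌈α⌉` and `q_D = α - ⌈α⌉ + 1`):
`φ^C(w, t) = (-1)^⌊α⌋ · (sin(απ)/(π·q_D)) · ∫_a^t y^{(m)}(τ) · exp(-(t-τ)·w^{1/q_D}) dτ`. -/
noncomputable def phiC (a T α : ℝ) (y : ℝ → ℝ) (w t : ℝ) : ℝ :=
  (-1 : ℝ) ^ ⌊α⌋ * (Real.sin (α * π) / (π * (α - (⌈α⌉ : ℝ) + 1))) *
    ∫ τ in a..t, iteratedDerivWithin ⌈α⌉₊ y (Set.Icc a (a + T)) τ *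
      Real.exp (-(t - τ) * w ^ (1 / (α - (⌈α⌉ : ℝ) + 1)))

/-- `s * exp (-δ * s)` tends to zero at infinity. -/
lemma tendsto_mul_exp_neg_mul_atTop {δ : ℝ} (hδ : 0 < δ) :
    Tendsto (fun s : ℝ => s * exp (-δ * s)) atTop (nhds 0) := by
  simpa using tendsto_rpow_mul_exp_neg_mul_atTop_nhds_zero 1 δ hδ

lemma integral_mul_exp_neg_sub_mul (a t s : ℝ) :
    ∫ τ in a..t, s * exp (-(t - τ) * s) = 1 - exp (-(t - a) * s) := by
  have h : ∀ τ ∈ uIcc a t,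
      HasDerivAt (fun τ => exp (-(t - τ) * s)) (s * exp (-(t - τ) * s)) τ := by
    intro τ _
    have h₁ : HasDerivAt (fun τ => -(t - τ) * s) s τ := by
      simpa using (((hasDerivAt_id τ).const_sub t).neg.mul_const s)
    simpa [mul_comm] using h₁.exp
  rw [intervalIntegral.integral_eq_sub_of_hasDerivAt h
    (Continuous.intervalIntegrable (by fun_prop) _ _)]
  simp

/-- Watson-type limit: the one-sided exponential kernels `s * exp (-(t - τ) * s)` concentrate
at the right endpoint `t` as `s → ∞`. -/
lemma tendsto_mul_integral_mul_exp_neg_sub_mul {a t : ℝ} (hat : a < t) {f : ℝ → ℝ}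
    (hf : ContinuousOn f (Icc a t)) :
    Tendsto (fun s : ℝ => s * ∫ τ in a..t, f τ * exp (-(t - τ) * s)) atTop (nhds (f t)) := by
  have key : Tendsto
      (fun s : ℝ => ∫ τ in Ioc a t, (s * exp (-(t - τ) * s)) • f τ) atTop (nhds (f t)) := by
    refine tendsto_setIntegral_peak_smul_of_integrableOn_of_tendsto (x₀ := t)
      (φ := fun s τ : ℝ => s * exp (-(t - τ) * s)) (t := Ioc a t)
      measurableSet_Ioc measurableSet_Ioc subset_rfl self_mem_nhdsWithin (by simp) ?_ ?_ ?_ ?_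
      ?_ ?_
    · filter_upwards [eventually_ge_atTop 0] with s hs τ _
      positivity
    · intro u hu htu
      obtain ⟨δ, hδ, hball⟩ := Metric.isOpen_iff.1 hu t htu
      rw [Metric.tendstoUniformlyOn_iff]
      intro ε hε
      filter_upwards [(tendsto_mul_exp_neg_mul_atTop hδ).eventually_lt_const hε,
        eventually_ge_atTop 0] with s hs hs0 τ hτ
      have hτδ : δ ≤ t - τ := by
        by_contra! hlt
        refine hτ.2 (hball ?_)
        rw [Metric.mem_ball, Real.dist_eq, abs_sub_comm, abs_of_nonneg (by linarith [hτ.1.2])]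
        exact hlt
      rw [Pi.zero_apply, dist_zero_left, Real.norm_of_nonneg (by positivity)]
      refine lt_of_le_of_lt ?_ hs
      gcongr
    · have h : Tendsto (fun s : ℝ => 1 - exp (-(t - a) * s)) atTop (nhds (1 - 0)) := by
        refine tendsto_const_nhds.sub (tendsto_exp_atBot.comp ?_)
        exact tendsto_id.const_mul_atTop_of_neg (by linarith)
      rw [sub_zero] at h
      refine h.congr fun s => ?_
      rw [← integral_mul_exp_neg_sub_mul, intervalIntegral.integral_of_le hat.le]
    · exact Eventually.of_forall fun s =>
        Continuous.aestronglyMeasurable (by fun_prop)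
    · exact hf.integrableOn_Icc.mono_set Ioc_subset_Icc_self
    · exact (hf t (right_mem_Icc.2 hat.le)).mono Ioc_subset_Icc_self
  refine key.congr fun s => ?_
  rw [intervalIntegral.integral_of_le hat.le, ← integral_const_mul]
  refine integral_congr_ae (Eventually.of_forall fun τ => ?_)
  simp only [smul_eq_mul]
  ring

/-- For fixed `t ∈ (a, a+T]`, with `q_D = α - ⌈α⌉ + 1`,
`lim_{w→∞} w^{1/q_D} · φ^C(w, t) = (-1)^⌊α⌋ · (sin(απ)/(π·q_D)) · y^{(m)}(t) =: c^C`;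
in particular, if `y^{(m)}(t) ≠ 0` then `φ^C(w, t) = c^C · w^{-1/q_D} · (1 + o(1))`
as `w → ∞`, and `c^C ≠ 0`. -/
theorem phiC_asymptotics (a T α : ℝ) (hT : 0 < T) (hα : 0 < α) (hαni : ∀ n : ℤ, α ≠ n)
    (y : ℝ → ℝ) (hy : ContDiffOn ℝ (⌈α⌉₊ : ℕ∞) y (Set.Icc a (a + T)))
    (t : ℝ) (ht : t ∈ Set.Ioc a (a + T)) :
    Tendsto (fun w : ℝ => w ^ (1 / (α - (⌈α⌉ : ℝ) + 1)) * phiC a T α y w t) atTop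
      (nhds ((-1 : ℝ) ^ ⌊α⌋ * (Real.sin (α * π) / (π * (α - (⌈α⌉ : ℝ) + 1))) *
        iteratedDerivWithin ⌈α⌉₊ y (Set.Icc a (a + T)) t)) ∧
    (iteratedDerivWithin ⌈α⌉₊ y (Set.Icc a (a + T)) t ≠ 0 →
      (fun w : ℝ => phiC a T α y w t) ~[atTop]
        (fun w : ℝ => ((-1 : ℝ) ^ ⌊α⌋ * (Real.sin (α * π) / (π * (α - (⌈α⌉ : ℝ) + 1))) *
          iteratedDerivWithin ⌈α⌉₊ y (Set.Icc a (a + T)) t) *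
            w ^ (-(1 / (α - (⌈α⌉ : ℝ) + 1)))) ∧
      (-1 : ℝ) ^ ⌊α⌋ * (Real.sin (α * π) / (π * (α - (⌈α⌉ : ℝ) + 1))) *
        iteratedDerivWithin ⌈α⌉₊ y (Set.Icc a (a + T)) t ≠ 0) := by
  have hq : 0 < α - (⌈α⌉ : ℝ) + 1 := by linarith [Int.ceil_lt_add_one α]
  set q : ℝ := α - (⌈α⌉ : ℝ) + 1 with hq_def
  set D : ℝ → ℝ := iteratedDerivWithin ⌈α⌉₊ y (Icc a (a + T)) with hD
  set K : ℝ := (-1 : ℝ) ^ ⌊α⌋ * (Real.sin (α * π) / (π * q)) with hK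
  have hDcont : ContinuousOn D (Icc a t) :=
    (hy.continuousOn_iteratedDerivWithin (by norm_cast)
      (uniqueDiffOn_Icc (by linarith))).mono (Icc_subset_Icc_right ht.2)
  have hlim : Tendsto (fun w : ℝ => w ^ (1 / q) * phiC a T α y w t) atTop (nhds (K * D t)) := by
    refine (((tendsto_mul_integral_mul_exp_neg_sub_mul ht.1 hDcont).comp
      (tendsto_rpow_atTop (one_div_pos.2 hq))).const_mul K).congr fun w => ?_
    simp only [phiC, Function.comp_apply, ← hq_def, ← hD, ← hK]
    ring
  refine ⟨hlim, fun hDt => ?_⟩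
  have hsin : Real.sin (α * π) ≠ 0 := by
    rw [Real.sin_ne_zero_iff]
    intro n hn
    exact hαni n (mul_right_cancel₀ pi_ne_zero hn).symm
  have hc : K * D t ≠ 0 :=
    mul_ne_zero (mul_ne_zero (zpow_ne_zero _ (by norm_num))
      (div_ne_zero hsin (mul_ne_zero pi_ne_zero hq.ne'))) hDt
  refine ⟨isEquivalent_of_tendsto_one ?_, hc⟩
  have hone := hlim.div_const (K * D t)
  rw [div_self hc] at hone
  refine hone.congr' ?_
  filter_upwards [eventually_gt_atTop 0] with w hw
  have hw' : w ^ (1 / q) ≠ 0 := (rpow_pos_of_pos hw _).ne'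
  rw [Pi.div_apply, rpow_neg hw.le]
  field_simp
end

section
/- Let a < t be real numbers and let g : [a, t] → ℝ be continuous. Then lim_{λ → ∞} λ · ∫_a^t g(τ) · exp(-(t-τ)·λ) dτ = g(t). -/
open Real MeasureTheory Set Filter

theorem tendsto_mul_exp_neg_mul_atTop_nhds_zero {b : ℝ} (hb : 0 < b) :
    Tendsto (fun lam : ℝ => lam * Real.exp (-b * lam)) atTop (nhds 0) := by
  simpa using tendsto_rpow_mul_exp_neg_mul_atTop_nhds_zero 1 b hb

theorem integral_mul_exp_kernel (a t lam : ℝ) :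
    ∫ τ in a..t, lam * Real.exp (-(t - τ) * lam) = 1 - Real.exp (-(t - a) * lam) := by
  have hderiv : ∀ τ ∈ uIcc a t, HasDerivAt (fun τ => Real.exp (-(t - τ) * lam))
      (lam * Real.exp (-(t - τ) * lam)) τ := by
    intro τ _
    convert ((((hasDerivAt_id' τ).const_sub t).fun_neg).mul_const lam).exp using 1
    ring
  rw [intervalIntegral.integral_eq_sub_of_hasDerivAt hderiv
    (Continuous.intervalIntegrable (by fun_prop) _ _)]
  simp

/-- If `a < t` and `g` is continuous on `[a, t]`, then
`lim_{λ → ∞} λ · ∫_a^t g(τ) · exp(-(t-τ)·λ) dτ = g(t)`. -/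
theorem tendsto_lambda_integral_exp_kernel (a t : ℝ) (hat : a < t)
    (g : ℝ → ℝ) (hg : ContinuousOn g (Set.Icc a t)) :
    Tendsto (fun lam : ℝ => lam * ∫ τ in a..t, g τ * Real.exp (-(t - τ) * lam)) atTop
      (nhds (g t)) := by
  have key : Tendsto (fun lam : ℝ => ∫ τ in Ioc a t, (lam * Real.exp (-(t - τ) * lam)) • g τ)
      atTop (nhds (g t)) := by
    refine tendsto_setIntegral_peak_smul_of_integrableOn_of_tendsto (x₀ := t)
      measurableSet_Ioc measurableSet_Ioc subset_rfl self_mem_nhdsWithin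
      measure_Ioc_lt_top.ne ?_ ?_ ?_ ?_ ?_ ?_
    · filter_upwards [eventually_ge_atTop 0] with lam hlam τ _
      positivity
    · intro u hu htu
      obtain ⟨δ, hδ, hball⟩ := Metric.isOpen_iff.1 hu t htu
      rw [Metric.tendstoUniformlyOn_iff]
      intro ε hε
      filter_upwards [eventually_ge_atTop 0,
        (tendsto_mul_exp_neg_mul_atTop_nhds_zero hδ).eventually_lt_const hε] with lam hlam hlt τ hτ
      have hδτ : δ ≤ t - τ := by
        by_contra! h
        refine hτ.2 (hball ?_)
        rw [Metric.mem_ball, dist_comm, Real.dist_eq, abs_of_nonneg (sub_nonneg.2 hτ.1.2)]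
        exact h
      rw [Pi.zero_apply, dist_zero_left, Real.norm_of_nonneg (by positivity)]
      refine lt_of_le_of_lt ?_ hlt
      gcongr
    · have hexp : Tendsto (fun lam : ℝ => Real.exp (-(t - a) * lam)) atTop (nhds 0) :=
        Real.tendsto_exp_atBot.comp (tendsto_id.const_mul_atTop_of_neg (by linarith))
      simp_rw [← intervalIntegral.integral_of_le hat.le, integral_mul_exp_kernel]
      simpa using hexp.const_sub 1
    · exact Eventually.of_forall fun lam =>
        Continuous.aestronglyMeasurable (by fun_prop)
    · exact hg.integrableOn_Icc.mono_set Ioc_subset_Icc_self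
    · exact (hg t (right_mem_Icc.2 hat.le)).mono_left (nhdsWithin_mono _ Ioc_subset_Icc_self)
  refine key.congr fun lam => ?_
  rw [← intervalIntegral.integral_of_le hat.le, ← intervalIntegral.integral_const_mul]
  congr 1 with τ
  rw [smul_eq_mul]
  ring
end
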